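/- The mapping class of the Reeb homeomorphism is not conjugate to that of the translation: there is no orientation preserving homeomorphism Ψ of ℝ² with Ψ(ℤ₁) = ℤ₁ and Ψ(ℤ₂) = ℤ₂ such that Ψ∘R₀∘Ψ⁻¹ is isotopic to T relative to ℤ₁ ∪ ℤ₂. -/

import Mathlib

open Set

/-- The plane. -/
abbrev Plane : Type := ℝ × ℝ

/-- `f` is (the underlying function of) a homeomorphism of the plane. -/
def IsHomeoFun (f : Plane → Plane) : Prop :=
  ∃ e : Plane ≃ₜ Plane, ∀ x, e x = f x

/-- `g` and `g'` are isotopic relative to `O` : there is a continuous family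
`F (t, ·)`, `t ∈ [0,1]`, of homeomorphisms of the plane going from `g` to `g'`
and agreeing with `g` on `O` for all times. -/
def IsotopicRel (g g' : Plane → Plane) (O : Set Plane) : Prop :=
  ∃ F : ℝ × Plane → Plane, Continuous F ∧
    (∀ t ∈ Icc (0:ℝ) 1, IsHomeoFun fun x => F (t, x)) ∧
    (∀ x, F (0, x) = g x) ∧
    (∀ x, F (1, x) = g' x) ∧
    (∀ t ∈ Icc (0:ℝ) 1, ∀ x ∈ O, F (t, x) = g x)

/-- A homeomorphism of the plane is orientation preserving iff it is isotopic
to the identity. -/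
def OrientationPreserving (h : Plane ≃ₜ Plane) : Prop :=
  IsotopicRel id (⇑h) (∅ : Set Plane)

/-- A Brouwer homeomorphism: orientation preserving and fixed point free. -/
def IsBrouwer (h : Plane ≃ₜ Plane) : Prop :=
  OrientationPreserving h ∧ ∀ x, h x ≠ x

/-- The orbit of a point under a homeomorphism. -/
def horbit (h : Plane ≃ₜ Plane) (x : Plane) : Set Plane :=
  {y | ∃ n : ℤ, y = (h.toEquiv ^ n) x}

/-- `ℤ₁ = ℤ × {1}`. -/
def Z1 : Set Plane := {p | ∃ n : ℤ, p = ((n : ℝ), 1)}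

/-- `ℤ₂ = ℤ × {2}`. -/
def Z2 : Set Plane := {p | ∃ n : ℤ, p = ((n : ℝ), 2)}

/-- The shear homeomorphism `(x, y) ↦ (x + f y, y)`. -/
def shear (f : ℝ → ℝ) (hf : Continuous f) : Plane ≃ₜ Plane where
  toFun p := (p.1 + f p.2, p.2)
  invFun p := (p.1 - f p.2, p.2)
  left_inv p := by simp
  right_inv p := by simp
  continuous_toFun := (continuous_fst.add (hf.comp continuous_snd)).prodMk continuous_snd
  continuous_invFun := (continuous_fst.sub (hf.comp continuous_snd)).prodMk continuous_snd

/-- The translation `T (x, y) = (x + 1, y)`. -/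
def T : Plane ≃ₜ Plane := shear (fun _ => 1) continuous_const

/-- The twist `T₁ (x, y) = (x + 2 - y, y)`. -/
def T₁ : Plane ≃ₜ Plane := shear (fun y => 2 - y) (by continuity)

/-- The twist `T₂ (x, y) = (x + y - 1, y)`. -/
def T₂ : Plane ≃ₜ Plane := shear (fun y => y - 1) (by continuity)

/-- The model Reeb homeomorphism `R₀ = T₁ ∘ T₂⁻¹`, `R₀ (x, y) = (x + 3 - 2y, y)`. -/
def R₀ : Plane ≃ₜ Plane := shear (fun y => 3 - 2 * y) (by continuity)

/-- The Euclidean norm on the plane. -/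
noncomputable def planeNorm (p : Plane) : ℝ := Real.sqrt (p.1 ^ 2 + p.2 ^ 2)

/-- An angle function for a fixed point free map `h'` along a curve `γ`. -/
def IsAngleFunction (h' : Plane → Plane) (γ : ℝ → Plane) (θ : ℝ → ℝ) : Prop :=
  ContinuousOn θ (Icc 0 1) ∧
    ∀ t ∈ Icc (0:ℝ) 1,
      h' (γ t) - γ t =
        planeNorm (h' (γ t) - γ t) • (Real.cos (θ t), Real.sin (θ t))

/-- The conjugate `Φ ∘ h ∘ Φ⁻¹`. -/
def conjH (Φ h : Plane ≃ₜ Plane) : Plane ≃ₜ Plane := Φ.symm.trans (h.trans Φ)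

/-- An admissible straightening `Φ` for `(h, O₁, O₂)` : an orientation preserving
homeomorphism sending `O₁, O₂` to `ℤ₁, ℤ₂` such that `Φ ∘ h ∘ Φ⁻¹` is isotopic
relative to `ℤ₁ ∪ ℤ₂` to a homeomorphism translating each line `ℝ × {i}` by `±1`. -/
def AdmissibleStraightening (h : Plane ≃ₜ Plane) (O₁ O₂ : Set Plane)
    (Φ : Plane ≃ₜ Plane) : Prop :=
  OrientationPreserving Φ ∧ Φ '' O₁ = Z1 ∧ Φ '' O₂ = Z2 ∧
    ∃ ε₁ ε₂ : ℝ, (ε₁ = 1 ∨ ε₁ = -1) ∧ (ε₂ = 1 ∨ ε₂ = -1) ∧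
      ∃ g : Plane ≃ₜ Plane,
        (∀ x : ℝ, g (x, 1) = (x + ε₁, 1)) ∧
        (∀ x : ℝ, g (x, 2) = (x + ε₂, 2)) ∧
        IsotopicRel (⇑(conjH Φ h)) (⇑g) (Z1 ∪ Z2)

/-- A flow on the plane. -/
def IsFlow (φ : ℝ → Plane → Plane) : Prop :=
  Continuous (fun p : ℝ × Plane => φ p.1 p.2) ∧
    (∀ x, φ 0 x = x) ∧ ∀ s t x, φ (s + t) x = φ s (φ t x)

/-- A topological line in the plane: the image of a proper injective continuous
map from `ℝ` to the plane. -/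
def IsTopLine (L : Set Plane) : Prop :=
  ∃ f : ℝ → Plane, Continuous f ∧ Function.Injective f ∧ IsProperMap f ∧ range f = L

open Filter Topology unitInterval

/-- Continuous functions on a connected set with the same exponential agree once they agree
at one point. -/
theorem Complex.eqOn_of_exp_eqOn {A : Type*} [TopologicalSpace A] {s : Set A} {f g : A → ℂ}
    (hs : IsPreconnected s) (hf : ContinuousOn f s) (hg : ContinuousOn g s)
    (h : ∀ a ∈ s, Complex.exp (f a) = Complex.exp (g a)) {a₀ : A} (ha₀ : a₀ ∈ s)
    (h₀ : f a₀ = g a₀) : EqOn f g s :=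
  Complex.isCoveringMap_exp.eqOn_of_comp_eqOn hs hf hg
    (fun a ha => Subtype.ext (h a ha)) ha₀ h₀

/-- The homotopy lifting property of the complex exponential. -/
theorem Complex.exists_exp_homotopy_lift {A : Type*} [TopologicalSpace A] {H : I × A → ℂ}
    (hH : Continuous H) (hH0 : ∀ p, H p ≠ 0) {f : A → ℂ} (hf : Continuous f)
    (hfH : ∀ a, Complex.exp (f a) = H (0, a)) :
    ∃ L : I × A → ℂ, Continuous L ∧ (∀ p, Complex.exp (L p) = H p) ∧ ∀ a, L (0, a) = f a := by
  let H' : C(I × A, {z : ℂ // z ≠ 0}) := ⟨fun p => ⟨H p, hH0 p⟩, hH.subtype_mk _⟩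
  have h0 : ∀ a, H' (0, a) = ⟨Complex.exp (f a), Complex.exp_ne_zero _⟩ :=
    fun a => Subtype.ext (hfH a).symm
  refine ⟨Complex.isCoveringMap_exp.liftHomotopy H' ⟨f, hf⟩ h0, ContinuousMap.continuous _,
    fun p => ?_, fun a => Complex.isCoveringMap_exp.liftHomotopy_zero H' ⟨f, hf⟩ h0 a⟩
  exact congrArg Subtype.val
    (congrFun (Complex.isCoveringMap_exp.liftHomotopy_lifts H' ⟨f, hf⟩ h0) p)

namespace Plane

/-- The identification of the plane with `ℂ`. -/
noncomputable def toComplex : Plane ≃ₜ ℂ := Complex.equivRealProdCLM.symm.toHomeomorph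

@[fun_prop]
theorem continuous_toComplex : Continuous toComplex := toComplex.continuous

theorem toComplex_apply (p : Plane) : toComplex p = p.1 + p.2 * Complex.I :=
  Complex.equivRealProdCLM_symm_apply p

theorem toComplex_sub_ne_zero {x y : Plane} (h : x ≠ y) : toComplex y - toComplex x ≠ 0 :=
  sub_ne_zero.2 fun e => h (toComplex.injective e).symm

/-- The pairs of distinct points of the plane. -/
def offDiag : Set (Plane × Plane) := {p | p.1 ≠ p.2}

theorem isPreconnected_offDiag : IsPreconnected offDiag := by
  have h : IsPreconnected ((univ : Set Plane) ×ˢ ({0}ᶜ : Set Plane)) := by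
    refine isPreconnected_univ.prod
      (isConnected_compl_singleton_of_one_lt_rank ?_ 0).isPreconnected
    rw [rank_prod']
    norm_num
  convert h.image (fun p => (p.1, p.1 + p.2)) (by fun_prop) using 1
  ext ⟨x, y⟩
  constructor
  · intro h
    exact ⟨(x, y - x), ⟨mem_univ _, sub_ne_zero.2 (Ne.symm h)⟩, Prod.ext rfl (add_sub_cancel x y)⟩
  · rintro ⟨⟨a, b⟩, ⟨-, hb⟩, h⟩ e
    obtain ⟨rfl, rfl⟩ := Prod.mk.inj h
    exact hb (left_eq_add.1 e)

/-- A continuous choice of logarithm of the rotation and stretching of the vector from `x` to `y`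
under a map `h` of the plane. -/
structure IsRotationLog (h : Plane → Plane) (L : Plane → Plane → ℂ) : Prop where
  continuousOn : ContinuousOn (fun p : Plane × Plane => L p.1 p.2) offDiag
  exp_eq : ∀ x y, x ≠ y → Complex.exp (L x y) =
    (toComplex (h y) - toComplex (h x)) / (toComplex y - toComplex x)

/-- The homotopy lifting property, for families of functions of pairs of distinct points. -/
theorem exists_offDiag_lift {F G : ℝ × Plane → Plane} (hF : Continuous F)
    (hG : Continuous G) (hFi : ∀ t ∈ Icc (0 : ℝ) 1, Function.Injective fun x => F (t, x))
    (hGi : ∀ t ∈ Icc (0 : ℝ) 1, Function.Injective fun x => G (t, x))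
    {f : Plane → Plane → ℂ} (hf : ContinuousOn (fun p : Plane × Plane => f p.1 p.2) offDiag)
    (hfF : ∀ x y, x ≠ y → Complex.exp (f x y) =
      (toComplex (F (0, y)) - toComplex (F (0, x))) /
        (toComplex (G (0, y)) - toComplex (G (0, x)))) :
    ∃ L : I × offDiag → ℂ, Continuous L ∧
      (∀ t : I, ∀ p : offDiag, Complex.exp (L (t, p)) =
        (toComplex (F (t, p.1.2)) - toComplex (F (t, p.1.1))) /
          (toComplex (G (t, p.1.2)) - toComplex (G (t, p.1.1)))) ∧
      ∀ p : offDiag, L (0, p) = f p.1.1 p.1.2 := by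
  have hne : ∀ {K : ℝ × Plane → Plane},
      (∀ t ∈ Icc (0 : ℝ) 1, Function.Injective fun x => K (t, x)) → ∀ q : I × offDiag,
      toComplex (K (q.1, q.2.1.2)) - toComplex (K (q.1, q.2.1.1)) ≠ 0 := fun hK q =>
    toComplex_sub_ne_zero fun e => q.2.2 (hK q.1 q.1.2 e)
  obtain ⟨L, hL, hexp, h0⟩ := Complex.exists_exp_homotopy_lift (A := offDiag)
    (H := fun q => (toComplex (F (q.1, q.2.1.2)) - toComplex (F (q.1, q.2.1.1))) /
          (toComplex (G (q.1, q.2.1.2)) - toComplex (G (q.1, q.2.1.1))))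
    (Continuous.div (by fun_prop) (by fun_prop) (hne hGi))
    (fun q => div_ne_zero (hne hFi q) (hne hGi q))
    (f := fun p => f p.1.1 p.1.2) (continuousOn_iff_continuous_domRestrict.1 hf)
    (fun p => hfF _ _ p.2)
  exact ⟨L, hL, fun t p => hexp (t, p), h0⟩

end Plane

theorem IsHomeoFun.injective {f : Plane → Plane} (hf : IsHomeoFun f) : Function.Injective f := by
  obtain ⟨e, he⟩ := hf
  rw [← funext he]
  exact e.injective

namespace Plane

/-- An orientation preserving homeomorphism has a symmetric rotation logarithm. -/
theorem exists_symm_isRotationLog {Ψ : Plane ≃ₜ Plane} (hΨ : OrientationPreserving Ψ) :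
    ∃ L, IsRotationLog Ψ L ∧ ∀ x y, x ≠ y → L x y = L y x := by
  classical
  obtain ⟨F, hF, hFe, hF0, hF1, -⟩ := hΨ
  obtain ⟨M, hM, hexp, h0⟩ := exists_offDiag_lift hF (G := fun q => q.2) continuous_snd
    (fun t ht => (hFe t ht).injective) (fun _ _ _ _ e => e)
    (f := fun _ _ => 0) continuousOn_const (fun x y h => by
      simp only [hF0, id]
      rw [Complex.exp_zero, div_self (toComplex_sub_ne_zero h)])
  obtain ⟨L, hext⟩ : ∃ L : Plane → Plane → ℂ, ∀ x y (h : (x, y) ∈ offDiag),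
      L x y = M (1, ⟨(x, y), h⟩) :=
    ⟨fun x y => if h : (x, y) ∈ offDiag then M (1, ⟨(x, y), h⟩) else 0, fun x y h => dif_pos h⟩
  refine ⟨L, ⟨?_, ?_⟩, ?_⟩
  · rw [continuousOn_iff_continuous_domRestrict]
    have : Continuous fun p : offDiag => M (1, p) := by fun_prop
    convert this using 2 with p
    exact hext _ _ p.2
  · intro x y h
    rw [hext x y h, hexp]
    simp [hF1]
  · intro x y h
    rw [hext x y h, hext y x h.symm]
    refine Complex.eqOn_of_exp_eqOn (s := univ) (f := fun t : I => M (t, ⟨(x, y), h⟩))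
      (g := fun t : I => M (t, ⟨(y, x), h.symm⟩)) isPreconnected_univ
      (by fun_prop) (by fun_prop) (fun t _ => ?_) (mem_univ 0) (by simp [h0]) (mem_univ 1)
    rw [hexp, hexp, ← neg_sub, ← neg_sub (toComplex x), neg_div_neg_eq]

/-- If `h` is isotopic to `h'` relative to `O`, a logarithm of the ratio of the vectors spanned by
the images of two points under `h` and `h'` is constant on the pairs of points of `O`, as soon as
`h'` preserves vectors. -/
theorem exists_eq_of_isotopicRel {h h' : Plane → Plane} {O : Set Plane}
    (hiso : IsotopicRel h h' O)
    (hvec : ∀ x y, toComplex (h' y) - toComplex (h' x) = toComplex y - toComplex x)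
    {f : Plane → Plane → ℂ} (hf : IsRotationLog h f) :
    ∃ κ, ∀ x ∈ O, ∀ y ∈ O, x ≠ y → f x y = κ := by
  obtain ⟨F, hF, hFe, hF0, hF1, hFO⟩ := hiso
  obtain ⟨M, hM, hexp, h0⟩ := exists_offDiag_lift hF (G := fun q => q.2) continuous_snd
    (fun t ht => (hFe t ht).injective) (fun _ _ _ _ e => e) hf.continuousOn
    (fun x y h => by simpa only [hF0] using hf.exp_eq x y h)
  let p₀ : offDiag := ⟨((0, 0), (1, 0)), by simp [offDiag]⟩
  have : PreconnectedSpace offDiag := Subtype.preconnectedSpace isPreconnected_offDiag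
  have hone : ∀ p, Complex.exp (M (1, p)) = 1 := fun p => by
    rw [hexp]
    simp only [Icc.coe_one, hF1, hvec]
    exact div_self (toComplex_sub_ne_zero p.2)
  refine ⟨M (1, p₀), fun x hx y hy hxy => ?_⟩
  have h1 : M (1, ⟨(x, y), hxy⟩) = M (1, p₀) :=
    Complex.eqOn_of_exp_eqOn (f := fun p : offDiag => M (1, p)) (g := fun _ => M (1, p₀))
      isPreconnected_univ (by fun_prop) continuousOn_const (fun p _ => by rw [hone, hone])
      (mem_univ p₀) rfl (mem_univ _)
  rw [← h1, ← h0 ⟨(x, y), hxy⟩]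
  refine Complex.eqOn_of_exp_eqOn (f := fun _ : I => M (0, ⟨(x, y), hxy⟩))
    (g := fun t : I => M (t, ⟨(x, y), hxy⟩)) isPreconnected_univ continuousOn_const
    (by fun_prop) (fun t _ => ?_) (mem_univ 0) rfl (mem_univ 1)
  rw [hexp, hexp]
  simp [hFO t t.2 x hx, hFO t t.2 y hy, hF0]

/-- Seen from a point far away, a compact set looks like a point. -/
theorem eventually_norm_sub_div_sub_lt (h : Plane ≃ₜ Plane) {K : Set Plane} (hK : IsCompact K)
    (x : Plane) {ε : ℝ} (hε : 0 < ε) :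
    ∀ᶠ y in cocompact Plane, ∀ z ∈ K,
      ‖(toComplex (h y) - toComplex (h z)) / (toComplex (h y) - toComplex (h x)) - 1‖ < ε := by
  obtain ⟨M, hM⟩ := hK.exists_bound_of_continuousOn
    (f := fun z => toComplex (h x) - toComplex (h z)) (by fun_prop)
  have ht : Tendsto (fun y => ‖toComplex (h y) - toComplex (h x)‖) (cocompact Plane) atTop :=
    (tendsto_norm_cocompact_atTop.comp
      ((h.trans (toComplex.trans (Homeomorph.subRight (toComplex (h x))))
        ).isClosedEmbedding.tendsto_cocompact))
  filter_upwards [ht.eventually_gt_atTop (M / ε), ht.eventually_gt_atTop 0] with y hy hy0 z hz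
  have hne := norm_pos_iff.1 hy0
  rw [div_sub_one hne, sub_sub_sub_cancel_left, norm_div, div_lt_iff₀ hy0]
  rw [div_lt_iff₀ hε] at hy
  linarith [hM z hz]

theorem _root_.Complex.mem_slitPlane_of_norm_sub_one_lt {z : ℂ} (hz : ‖z - 1‖ < 1) :
    z ∈ Complex.slitPlane := by
  have := Complex.mem_slitPlane_of_norm_lt_one hz
  simpa using this

/-- The rotation of the vector from `x` to a point `y` near infinity depends little on `x`. -/
theorem IsRotationLog.tendsto_sub {Ψ : Plane ≃ₜ Plane} {L : Plane → Plane → ℂ}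
    (hL : IsRotationLog Ψ L) (x x' : Plane) :
    Tendsto (fun y => L x' y - L x y) (cocompact Plane) (𝓝 0) := by
  let w (h : Plane ≃ₜ Plane) (z y : Plane) : ℂ :=
    (toComplex (h y) - toComplex (h z)) / (toComplex (h y) - toComplex (h x))
  have hK : IsCompact (segment ℝ x x') := by
    rw [segment_eq_image_lineMap]
    exact isCompact_Icc.image AffineMap.lineMap_continuous
  have hxK := left_mem_segment ℝ x x'
  have hx'K := right_mem_segment ℝ x x'
  have hw : ∀ h, Tendsto (fun y => Complex.log (w h x' y)) (cocompact Plane) (𝓝 0) := by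
    intro h
    have h1 : Tendsto (fun y => w h x' y) (cocompact Plane) (𝓝 1) := by
      rw [Metric.tendsto_nhds]
      intro ε hε
      filter_upwards [eventually_norm_sub_div_sub_lt h hK x hε] with y hy
      rw [dist_eq_norm]
      exact hy x' hx'K
    simpa using h1.clog Complex.one_mem_slitPlane
  have hlim := (hw Ψ).sub (hw (Homeomorph.refl _))
  rw [sub_zero] at hlim
  refine hlim.congr' ?_
  filter_upwards [eventually_norm_sub_div_sub_lt Ψ hK x one_pos,
    eventually_norm_sub_div_sub_lt (Homeomorph.refl _) hK x one_pos,
    hK.compl_mem_cocompact] with y hy hy' hyK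
  have hzy : ∀ z ∈ segment ℝ x x', z ≠ y := fun z hz e => hyK (e ▸ hz)
  have hnΨ : ∀ z ∈ segment ℝ x x', toComplex (Ψ y) - toComplex (Ψ z) ≠ 0 :=
    fun z hz => toComplex_sub_ne_zero fun e => hzy z hz (Ψ.injective e)
  have hn : ∀ z ∈ segment ℝ x x', toComplex y - toComplex z ≠ 0 :=
    fun z hz => toComplex_sub_ne_zero (hzy z hz)
  have hsΨ : ∀ z ∈ segment ℝ x x', w Ψ z y ∈ Complex.slitPlane := fun z hz =>
    Complex.mem_slitPlane_of_norm_sub_one_lt (hy z hz)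
  have hs : ∀ z ∈ segment ℝ x x', w (Homeomorph.refl _) z y ∈ Complex.slitPlane := fun z hz =>
    Complex.mem_slitPlane_of_norm_sub_one_lt (hy' z hz)
  refine Complex.eqOn_of_exp_eqOn (s := segment ℝ x x')
    (f := fun z => Complex.log (w Ψ z y) - Complex.log (w (Homeomorph.refl _) z y))
    (g := fun z => L z y - L x y) (convex_segment x x').isPreconnected ?_ ?_ ?_ hxK ?_ hx'K
  · refine ContinuousOn.sub (ContinuousOn.clog ?_ hsΨ) (ContinuousOn.clog ?_ hs) <;>
    · dsimp only [w]
      fun_prop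
  · refine ContinuousOn.sub (hL.continuousOn.comp (f := fun z => (z, y)) (by fun_prop) ?_)
      continuousOn_const
    exact hzy
  · intro z hz
    rw [Complex.exp_sub, Complex.exp_sub, Complex.exp_log (Complex.slitPlane_ne_zero (hsΨ z hz)),
      Complex.exp_log (Complex.slitPlane_ne_zero (hs z hz)), hL.exp_eq z y (hzy z hz),
      hL.exp_eq x y (hzy x hxK)]
    simp only [w, Homeomorph.refl_apply, id]
    have := hnΨ z hz
    have := hnΨ x hxK
    have := hn z hz
    have := hn x hxK
    field_simp
  · simp only [w, Homeomorph.refl_apply, id]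
    rw [div_self (hnΨ x hxK), div_self (hn x hxK)]
    simp

/-- The linear shear `R₀` rotates vectors by less than a half turn. -/
theorem R₀_div_mem_slitPlane {x y : Plane} (h : x ≠ y) :
    (toComplex (R₀ y) - toComplex (R₀ x)) / (toComplex y - toComplex x) ∈ Complex.slitPlane := by
  have hxy := toComplex_sub_ne_zero h
  rw [Complex.mem_slitPlane_iff]
  by_cases hy : y.2 = x.2
  · left
    rw [show toComplex (R₀ y) - toComplex (R₀ x) = toComplex y - toComplex x by
      simp [R₀, shear, toComplex_apply, hy], div_self hxy]
    exact one_pos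
  · right
    have hn := (Complex.normSq_pos.2 hxy).ne'
    have hy' := sub_ne_zero.2 hy
    rw [Complex.div_im, ← sub_div, div_ne_zero_iff]
    refine ⟨?_, hn⟩
    have : (toComplex (R₀ y) - toComplex (R₀ x)).im * (toComplex y - toComplex x).re -
        (toComplex (R₀ y) - toComplex (R₀ x)).re * (toComplex y - toComplex x).im =
          2 * (y.2 - x.2) ^ 2 := by
      simp [R₀, shear, toComplex_apply]
      ring
    rw [this]
    positivity

/-- The rotation of the vector from `x` to `y` under a conjugate of `R₀` isotopic to `T`. -/
theorem IsRotationLog.exists_R₀_eq {Ψ : Plane ≃ₜ Plane} {L : Plane → Plane → ℂ}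
    (hL : IsRotationLog Ψ L) {O : Set Plane} (hO : Ψ '' O = O)
    (hiso : IsotopicRel (conjH Ψ R₀) T O) :
    ∃ κ, ∀ x ∈ O, ∀ y ∈ O, x ≠ y → L (R₀ x) (R₀ y) + Complex.log
      ((toComplex (R₀ y) - toComplex (R₀ x)) / (toComplex y - toComplex x)) = L x y + κ := by
  have hΨc := Ψ.symm.continuous
  have hRc := R₀.continuous
  obtain ⟨κ, hκ⟩ := exists_eq_of_isotopicRel hiso
    (fun x y => by
      simp [T, shear, toComplex_apply]
      ring)
    (f := fun u v => L (R₀ (Ψ.symm u)) (R₀ (Ψ.symm v)) + Complex.log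
      ((toComplex (R₀ (Ψ.symm v)) - toComplex (R₀ (Ψ.symm u))) /
        (toComplex (Ψ.symm v) - toComplex (Ψ.symm u))) - L (Ψ.symm u) (Ψ.symm v))
    ⟨by
      have hm : ∀ p ∈ offDiag, Ψ.symm p.1 ≠ Ψ.symm p.2 := fun p hp => Ψ.symm.injective.ne hp
      refine ContinuousOn.sub (ContinuousOn.add ?_ (ContinuousOn.clog (ContinuousOn.div
        (by fun_prop) (by fun_prop) fun p hp => toComplex_sub_ne_zero (hm p hp))
        fun p hp => R₀_div_mem_slitPlane (hm p hp))) ?_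
      · exact hL.continuousOn.comp (f := fun p => (R₀ (Ψ.symm p.1), R₀ (Ψ.symm p.2)))
          (by fun_prop) fun p hp => R₀.injective.ne (hm p hp)
      · exact hL.continuousOn.comp (f := fun p : Plane × Plane => (Ψ.symm p.1, Ψ.symm p.2))
          (by fun_prop) fun p hp => hm p hp, fun u v huv => by
      have h1 : Ψ.symm u ≠ Ψ.symm v := Ψ.symm.injective.ne huv
      have h2 := R₀.injective.ne h1
      have := toComplex_sub_ne_zero h1
      have := toComplex_sub_ne_zero h2
      have := toComplex_sub_ne_zero huv
      rw [Complex.exp_sub, Complex.exp_add, hL.exp_eq _ _ h1, hL.exp_eq _ _ h2,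
        Complex.exp_log (Complex.slitPlane_ne_zero (R₀_div_mem_slitPlane h1))]
      simp only [conjH, Homeomorph.trans_apply, Homeomorph.apply_symm_apply]
      field_simp⟩
  refine ⟨κ, fun x hx y hy hxy => ?_⟩
  have := hκ (Ψ x) (hO ▸ mem_image_of_mem Ψ hx) (Ψ y) (hO ▸ mem_image_of_mem Ψ hy)
    (Ψ.injective.ne hxy)
  simp only [Homeomorph.symm_apply_apply] at this
  linear_combination this

/-- Moving to infinity along a horizontal line. -/
theorem tendsto_mk_cocompact {u : ℕ → ℝ} (hu : Tendsto (fun l => ‖u l‖) atTop atTop) (b : ℝ) :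
    Tendsto (fun l => (u l, b)) atTop (cocompact Plane) :=
  tendsto_cocompact_of_tendsto_dist_comp_atTop (0 : Plane)
    (tendsto_atTop_mono (fun l => by simp [dist_eq_norm, Prod.norm_def]) hu)

end Plane

theorem Complex.log_div_of_im_pos {z w : ℂ} (hz : 0 < z.im) (hw : 0 < w.im) :
    Complex.log (z / w) = Complex.log z - Complex.log w := by
  have hz0 : z ≠ 0 := fun h => by simp [h] at hz
  have hw0 : w ≠ 0 := fun h => by simp [h] at hw
  have hz' := Complex.arg_nonneg_iff.2 hz.le
  have hw' := Complex.arg_nonneg_iff.2 hw.le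
  have hzπ := Complex.arg_lt_pi_iff.2 (.inr hz.ne')
  have hwπ := Complex.arg_lt_pi_iff.2 (.inr hw.ne')
  rw [← Complex.log_exp (x := Complex.log z - Complex.log w), Complex.exp_sub,
    Complex.exp_log hz0, Complex.exp_log hw0] <;>
  · rw [Complex.sub_im, Complex.log_im, Complex.log_im]
    linarith

open Plane

/-- The mapping class of the Reeb homeomorphism is not
conjugate to that of the translation. -/
theorem reeb_not_conjugate_to_translation :
    ¬ ∃ Ψ : Plane ≃ₜ Plane, OrientationPreserving Ψ ∧
        Ψ '' Z1 = Z1 ∧ Ψ '' Z2 = Z2 ∧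
        IsotopicRel (⇑(conjH Ψ R₀)) (⇑T) (Z1 ∪ Z2) := by
  rintro ⟨Ψ, hΨ, hZ1, hZ2, hiso⟩
  obtain ⟨L, hL, hsymm⟩ := Plane.exists_symm_isRotationLog hΨ
  obtain ⟨κ, hκ⟩ := hL.exists_R₀_eq (by rw [image_union, hZ1, hZ2]) hiso
  let P (n : ℤ) : Plane := ((n : ℝ), 1)
  let Q (n : ℤ) : Plane := ((n : ℝ), 2)
  have hP (n : ℤ) : P n ∈ Z1 ∪ Z2 := .inl ⟨n, rfl⟩
  have hQ (n : ℤ) : Q n ∈ Z1 ∪ Z2 := .inr ⟨n, rfl⟩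
  have hPne {n n' : ℤ} (h : n ≠ n') : P n ≠ P n' := by simpa [P] using h
  have hQne {n n' : ℤ} (h : n ≠ n') : Q n ≠ Q n' := by simpa [Q] using h
  have hPQne (n m : ℤ) : P n ≠ Q m := by simp [P, Q]
  have hRP (n : ℤ) : R₀ (P n) = P (n + 1) := by
    simp [P, R₀, shear]
    norm_num
  have hRQ (n : ℤ) : R₀ (Q n) = Q (n - 1) := by
    simp [Q, R₀, shear]
    norm_num
    ring
  have hPP (n n' : ℤ) (h : n ≠ n') (l : ℕ) :
      L (P (n + l)) (P (n' + l)) = L (P n) (P n') + l * κ := by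
    induction l with
    | zero => simp
    | succ l ih =>
      have hne : n + l ≠ n' + l := by omega
      have := hκ _ (hP (n + l)) _ (hP (n' + l)) (hPne hne)
      rw [hRP, hRP, show toComplex (P (n' + l + 1)) - toComplex (P (n + l + 1)) =
        toComplex (P (n' + l)) - toComplex (P (n + l)) by simp [P, toComplex_apply],
        div_self (toComplex_sub_ne_zero (hPne hne)), Complex.log_one] at this
      push_cast
      rw [← add_assoc, ← add_assoc]
      linear_combination this + ih
  have hQQ (n n' : ℤ) (h : n ≠ n') (l : ℕ) :
      L (Q (n - l)) (Q (n' - l)) = L (Q n) (Q n') + l * κ := by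
    induction l with
    | zero => simp
    | succ l ih =>
      have hne : n - l ≠ n' - l := by omega
      have := hκ _ (hQ (n - l)) _ (hQ (n' - l)) (hQne hne)
      rw [hRQ, hRQ, show toComplex (Q (n' - l - 1)) - toComplex (Q (n - l - 1)) =
        toComplex (Q (n' - l)) - toComplex (Q (n - l)) by simp [Q, toComplex_apply],
        div_self (toComplex_sub_ne_zero (hQne hne)), Complex.log_one] at this
      push_cast
      rw [← sub_sub, ← sub_sub]
      linear_combination this + ih
  let ℓ (j : ℤ) : ℂ := Complex.log (j + Complex.I)
  have hPQ (n m : ℤ) (l : ℕ) :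
      L (P (n + l)) (Q (m - l)) + ℓ (m - n - 2 * l) = L (P n) (Q m) + ℓ (m - n) + l * κ := by
    induction l with
    | zero => simp
    | succ l ih =>
      have := hκ _ (hP (n + l)) _ (hQ (m - l)) (hPQne _ _)
      rw [hRP, hRQ, show toComplex (Q (m - l - 1)) - toComplex (P (n + l + 1)) =
          ((m - n - 2 * (l + 1 : ℕ) : ℤ) : ℂ) + Complex.I by
            simp [P, Q, toComplex_apply]
            ring,
        show toComplex (Q (m - l)) - toComplex (P (n + l)) =
          ((m - n - 2 * l : ℤ) : ℂ) + Complex.I by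
            simp [P, Q, toComplex_apply]
            ring,
        Complex.log_div_of_im_pos (by simp) (by simp)] at this
      rw [Nat.cast_succ (R := ℤ), ← add_assoc, ← sub_sub m]
      push_cast at this ih ⊢
      simp only [ℓ] at this ih ⊢
      push_cast at this ih ⊢
      linear_combination this + ih
  have hnorm : Tendsto (fun l : ℕ => ‖(l : ℝ)‖) atTop atTop := by
    simpa using tendsto_natCast_atTop_atTop (R := ℝ)
  have hPlim : Tendsto (fun l : ℕ => P l) atTop (cocompact Plane) := by
    simpa [P] using tendsto_mk_cocompact hnorm 1
  have hQlim : Tendsto (fun l : ℕ => Q l) atTop (cocompact Plane) := by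
    simpa [Q] using tendsto_mk_cocompact hnorm 2
  have hPlim' : Tendsto (fun l : ℕ => P (-l)) atTop (cocompact Plane) := by
    simpa [P] using tendsto_mk_cocompact (u := fun l => -(l : ℝ)) (by simpa using hnorm) 1
  have hQlim' : Tendsto (fun l : ℕ => Q (-l)) atTop (cocompact Plane) := by
    simpa [Q] using tendsto_mk_cocompact (u := fun l => -(l : ℝ)) (by simpa using hnorm) 2
  have hD := hL.tendsto_sub (P 0) (Q 0)
  have hlim := (((hD.comp hPlim).add (hD.comp hQlim)).sub (hD.comp hQlim')).sub (hD.comp hPlim')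
  have hexp := (hlim.div_const 2).cexp
  have hre := (Complex.continuous_re.tendsto _).comp hexp
  refine (lt_irrefl (0 : ℝ)) (lt_of_lt_of_le one_pos (le_of_tendsto
    (show Tendsto _ atTop (𝓝 (1 : ℝ)) by simpa using hre) ?_))
  filter_upwards [eventually_ge_atTop 1] with l hl
  have hl0 : (l : ℤ) ≠ 0 := by omega
  have e1 := hPQ 0 l l
  have e2 := hPQ (-l) 0 l
  have e3 := hPP (-l) 0 (by omega) l
  have e4 := hQQ l 0 hl0 l
  have e5 : (l : ℤ) - 0 - 2 * l = -l := by ring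
  have e6 : (0 : ℤ) - -l - 2 * l = -l := by ring
  rw [e5] at e1
  rw [e6] at e2
  simp only [zero_add, sub_self, sub_zero, neg_add_cancel, zero_sub, sub_neg_eq_add]
    at e1 e2 e3 e4
  simp only [Function.comp_apply]
  rw [hsymm (Q 0) (P l) (hPQne _ _).symm, hsymm (Q 0) (P (-l)) (hPQne _ _).symm]
  rw [hsymm (P (-l)) (P 0) (hPne (by omega))] at e3
  rw [hsymm (Q l) (Q 0) (hQne hl0)] at e4
  have key : Complex.exp (ℓ l - ℓ (-l)) = ((l : ℝ) + Complex.I) / (-(l : ℝ) + Complex.I) := by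
    simp only [ℓ]
    rw [Complex.exp_sub, Complex.exp_log, Complex.exp_log]
    · simp
    · exact fun h => by simpa using congrArg Complex.im h
    · exact fun h => by simpa using congrArg Complex.im h
  have hsum : (L (P l) (Q 0) - L (P 0) (P l) + (L (Q 0) (Q l) - L (P 0) (Q l)) -
      (L (Q 0) (Q (-l)) - L (P 0) (Q (-l))) - (L (P (-l)) (Q 0) - L (P 0) (P (-l)))) / 2 =
        ℓ l - ℓ (-l) := by
    linear_combination (e1 + e2 - e3 - e4) / 2
  have hl1 : (1 : ℝ) ≤ l := by exact_mod_cast hl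
  rw [hsum, key, Complex.div_re, ← add_div]
  refine div_nonpos_of_nonpos_of_nonneg ?_ (Complex.normSq_nonneg _)
  simp
  nlinarith
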